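/- There is an absolute constant c > 0 with the following property. Let f be a random p-biased function on 𝒳 with p ∈ (0,1), and let ε ∈ (0,1] and φ : 𝒳 → [0,1]. Then with probability at least 1 − 4·exp(−c·ε²·p²(1−p)² / ‖𝒟_x‖₂²) over the randomness of f, the normalization factor Z is strictly positive and the filtered sample distribution 𝒟 satisfies |Σ_{x∈𝒳} 𝒟(x)φ(x)f(x) − Σ_{x∈𝒳} 𝒟_x(x)φ(x)y(x)| ≤ ε. -/

import Mathlib

open Finset Real
open scoped Classical BigOperators

noncomputable section

/-- The real value of a boolean function at a point: `1` if `true`, `0` if `false`. -/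
def bval {X : Type} (f : X → Bool) (x : X) : ℝ := if f x then 1 else 0

/-- The probability weight of a particular function `f : X → Bool` when each value
`f x` is an independent Bernoulli(p) random variable. -/
def bweight {X : Type} [Fintype X] (p : ℝ) (f : X → Bool) : ℝ :=
  ∏ x, if f x then p else 1 - p

/-- The probability of an event `P` under a random `p`-biased function. -/
def bprob (X : Type) [Fintype X] (p : ℝ) (P : (X → Bool) → Prop) : ℝ :=
  ∑ f : X → Bool, bweight p f * (if P f then 1 else 0)

/-- The squared 2-norm of a weight function. -/
def norm2sq {X : Type} [Fintype X] (w : X → ℝ) : ℝ := ∑ x, w x ^ 2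

/-- The normalization factor `Z`. -/
def Zval {X : Type} [Fintype X] (Dx yy : X → ℝ) (p : ℝ) (f : X → Bool) : ℝ :=
  ∑ x, Dx x * ((1 - p) * yy x * bval f x + p * (1 - yy x) * (1 - bval f x))

/-- The filtered sample distribution. -/
def filtered {X : Type} [Fintype X] (Dx yy : X → ℝ) (p : ℝ) (f : X → Bool) (x : X) : ℝ :=
  Dx x * ((1 - p) * yy x * bval f x + p * (1 - yy x) * (1 - bval f x)) / Zval Dx yy p f

theorem aux_exp (u : ℝ) : Real.exp u ≤ u + Real.exp (u ^ 2) := by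
  have h2 := Real.add_one_le_exp (u ^ 2)
  by_cases h : |u| ≤ 1
  · have := (abs_le.mp (Real.abs_exp_sub_one_sub_id_le h)).2
    linarith
  · rcases lt_or_ge u 0 with hu | hu
    · rw [abs_of_neg hu] at h
      have : Real.exp u ≤ 1 := Real.exp_le_one_iff.mpr hu.le
      nlinarith
    · rw [abs_of_nonneg hu] at h
      have : Real.exp u ≤ Real.exp (u ^ 2) := Real.exp_le_exp.mpr (by nlinarith)
      linarith

theorem aux_bern (p t : ℝ) (h0 : 0 < p) (h1 : p < 1) :
    p * Real.exp (t * (1 - p)) + (1 - p) * Real.exp (t * (0 - p)) ≤ Real.exp (t ^ 2) := by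
  have e1 := aux_exp (t * (1 - p))
  have e2 := aux_exp (t * (0 - p))
  have l1 : Real.exp ((t * (1 - p)) ^ 2) ≤ Real.exp (t ^ 2) :=
    Real.exp_le_exp.mpr (by rw [mul_pow]; nlinarith [mul_nonneg (sq_nonneg t) (show 0 ≤ 1 - (1 - p) ^ 2 by nlinarith)])
  have l2 : Real.exp ((t * (0 - p)) ^ 2) ≤ Real.exp (t ^ 2) :=
    Real.exp_le_exp.mpr (by rw [mul_pow]; nlinarith [mul_nonneg (sq_nonneg t) (show 0 ≤ 1 - (0 - p) ^ 2 by nlinarith)])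
  have a1 := mul_le_mul_of_nonneg_left (e1.trans (add_le_add_right l1 _)) h0.le
  have a2 := mul_le_mul_of_nonneg_left (e2.trans (add_le_add_right l2 _)) (sub_pos.mpr h1).le
  nlinarith

theorem aux_prod {X : Type} [Fintype X] (p : ℝ) (g : X → Bool → ℝ) :
    ∑ f : X → Bool, bweight p f * ∏ x, g x (f x)
      = ∏ x, (p * g x true + (1 - p) * g x false) := by
  have h := Finset.prod_univ_sum (fun _ : X => (Finset.univ : Finset Bool))
    (fun x b => (if b = true then p else 1 - p) * g x b)
  simp only [Fintype.sum_bool, Fintype.piFinset_univ, Finset.prod_mul_distrib] at h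
  simp only [bweight]
  rw [← h]
  simp

theorem aux_one {X : Type} [Fintype X] (p : ℝ) : ∑ f : X → Bool, bweight p f = 1 := by
  have := aux_prod (X := X) p (fun _ _ => 1)
  simpa using this

theorem aux_nonneg {X : Type} [Fintype X] (p : ℝ) (h0 : 0 < p) (h1 : p < 1) (f : X → Bool) :
    0 ≤ bweight p f := by
  unfold bweight
  apply Finset.prod_nonneg
  intro x _
  split_ifs <;> linarith

theorem aux_tail {X : Type} [Fintype X] (p : ℝ) (h0 : 0 < p) (h1 : p < 1) (D a : X → ℝ)
    (ha : ∀ x, |a x| ≤ D x) (hD : 0 < norm2sq D) (t : ℝ) (ht : 0 ≤ t) :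
    bprob X p (fun f => t ≤ ∑ x, a x * (bval f x - p)) ≤ Real.exp (-t ^ 2 / (4 * norm2sq D)) := by
  set σ := norm2sq D with hσ
  set s := t / (2 * σ) with hs
  have hs0 : 0 ≤ s := by positivity
  have step : bprob X p (fun f => t ≤ ∑ x, a x * (bval f x - p)) ≤
      ∑ f : X → Bool, bweight p f *
        (Real.exp (-(s * t)) * ∏ x, Real.exp (s * a x * ((if f x = true then 1 else 0) - p))) := by
    unfold bprob
    apply Finset.sum_le_sum
    intro f _
    apply mul_le_mul_of_nonneg_left _ (aux_nonneg p h0 h1 f)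
    rw [← Real.exp_sum, ← Real.exp_add]
    split_ifs with h
    · apply Real.one_le_exp
      have := mul_le_mul_of_nonneg_left h hs0
      rw [Finset.mul_sum] at this
      simp only [bval, ← mul_assoc] at this
      linarith
    · exact (Real.exp_pos _).le
  have eq : ∑ f : X → Bool, bweight p f *
        (Real.exp (-(s * t)) * ∏ x, Real.exp (s * a x * ((if f x = true then 1 else 0) - p)))
      = Real.exp (-(s * t)) * ∏ x, (p * Real.exp (s * a x * (1 - p)) + (1 - p) * Real.exp (s * a x * (0 - p))) := by
    have := aux_prod (X := X) p (fun x b => Real.exp (s * a x * ((if b = true then 1 else 0) - p)))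
    simp only [if_true, Bool.false_eq_true, if_false] at this
    rw [← this, Finset.mul_sum]
    apply Finset.sum_congr rfl
    intro f _
    ring
  have bd : ∏ x, (p * Real.exp (s * a x * (1 - p)) + (1 - p) * Real.exp (s * a x * (0 - p)))
      ≤ Real.exp (s ^ 2 * σ) := by
    have : Real.exp (s ^ 2 * σ) = ∏ x, Real.exp ((s * D x) ^ 2) := by
      rw [← Real.exp_sum, hσ, norm2sq, Finset.mul_sum]
      simp only [mul_pow]
    rw [this]
    apply Finset.prod_le_prod
    · intro x _
      have : 0 < 1 - p := by linarith
      positivity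
    · intro x _
      refine (aux_bern p (s * a x) h0 h1).trans (Real.exp_le_exp.mpr ?_)
      rw [mul_pow, mul_pow]
      apply mul_le_mul_of_nonneg_left _ (sq_nonneg s)
      exact sq_le_sq.mpr ((ha x).trans (le_abs_self _))
  rw [eq] at step
  refine step.trans ((mul_le_mul_of_nonneg_left bd (Real.exp_pos _).le).trans ?_)
  rw [← Real.exp_add]
  apply le_of_eq
  congr 1
  rw [hs]
  field_simp
  ring

theorem aux_det (N Z m q ε : ℝ) (hq : 0 < q) (hε : 0 < ε) (hε1 : ε ≤ 1) (hm0 : 0 ≤ m) (hm1 : m ≤ 1)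
    (z1 : Z - q < q * ε / 4) (z2 : -(Z - q) < q * ε / 4)
    (n1 : N - q * m < q * ε / 4) (n2 : -(N - q * m) < q * ε / 4) :
    0 < Z ∧ |N / Z - m| ≤ ε := by
  have hqe : q * ε ≤ q := by nlinarith
  have hZ : 3 / 4 * q < Z := by linarith
  have hZ0 : 0 < Z := by linarith
  refine ⟨hZ0, ?_⟩
  have e : N / Z - m = (N - m * Z) / Z := by field_simp
  have k1 : m * (Z - q) ≤ q * ε / 4 := by
    have : 0 < q * ε := by positivity
    nlinarith [mul_le_mul_of_nonneg_left z1.le hm0]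
  have k2 : -(m * (Z - q)) ≤ q * ε / 4 := by
    have : 0 < q * ε := by positivity
    nlinarith [mul_le_mul_of_nonneg_left z2.le hm0]
  have k3 : 3 / 4 * q * ε < Z * ε := mul_lt_mul_of_pos_right hZ hε
  have : 0 < q * ε := by positivity
  rw [e, abs_div, abs_of_pos hZ0, div_le_iff₀ hZ0, abs_le]
  constructor <;> nlinarith

theorem stmt7 : ∃ c : ℝ, 0 < c ∧
    ∀ (X : Type) [Fintype X], ∀ (Dx yy : X → ℝ) (p ε : ℝ) (φ : X → ℝ),
      (∀ x, 0 ≤ Dx x) → (∀ x, Dx x ≤ 1) → (∑ x, Dx x) = 1 →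
      (∀ x, 0 ≤ yy x) → (∀ x, yy x ≤ 1) →
      0 < p → p < 1 → 0 < ε → ε ≤ 1 →
      (∀ x, 0 ≤ φ x) → (∀ x, φ x ≤ 1) →
      bprob X p (fun f =>
          0 < Zval Dx yy p f ∧
          |(∑ x, filtered Dx yy p f x * φ x * bval f x) - ∑ x, Dx x * φ x * yy x| ≤ ε) ≥
        1 - 4 * Real.exp (-(c * ε ^ 2 * p ^ 2 * (1 - p) ^ 2) / norm2sq Dx) := by
  refine ⟨1 / 64, by norm_num, ?_⟩
  intro X _ Dx yy p ε φ hD0 hD1 hDs hy0 hy1 hp0 hp1 he0 he1 hf0 hf1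
  have hσ : 0 < norm2sq Dx := by
    have hn : 0 ≤ norm2sq Dx := Finset.sum_nonneg fun x _ => sq_nonneg _
    rcases hn.lt_or_eq with h | h
    · exact h
    · exfalso
      have h' := (Finset.sum_eq_zero_iff_of_nonneg (fun x _ => sq_nonneg (Dx x))).mp h.symm
      have : ∑ x, Dx x = 0 := Finset.sum_eq_zero fun x hx => by
        simpa using h' x hx
      linarith
  set m := ∑ x, Dx x * φ x * yy x with hm
  have hm0 : 0 ≤ m := Finset.sum_nonneg fun x _ =>
    mul_nonneg (mul_nonneg (hD0 x) (hf0 x)) (hy0 x)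
  have hm1 : m ≤ 1 := by
    rw [← hDs]
    apply Finset.sum_le_sum
    intro x _
    have : φ x * yy x ≤ 1 := mul_le_one₀ (hf1 x) (hy0 x) (hy1 x)
    nlinarith [hD0 x]
  have hq : 0 < p * (1 - p) := mul_pos hp0 (by linarith)
  set a : X → ℝ := fun x => Dx x * (yy x - p) with hadef
  set b : X → ℝ := fun x => Dx x * ((1 - p) * (φ x * yy x)) with hbdef
  have ha : ∀ x, |a x| ≤ Dx x := by
    intro x
    rw [hadef]
    simp only
    rw [abs_mul, abs_of_nonneg (hD0 x)]
    apply mul_le_of_le_one_right (hD0 x)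
    rw [abs_le]
    constructor <;> linarith [hy0 x, hy1 x]
  have hb : ∀ x, |b x| ≤ Dx x := by
    intro x
    rw [hbdef]
    simp only
    rw [abs_mul, abs_of_nonneg (hD0 x)]
    apply mul_le_of_le_one_right (hD0 x)
    have h1 : φ x * yy x ≤ 1 := mul_le_one₀ (hf1 x) (hy0 x) (hy1 x)
    have h0 : 0 ≤ φ x * yy x := mul_nonneg (hf0 x) (hy0 x)
    rw [abs_of_nonneg (mul_nonneg (by linarith) h0)]
    exact mul_le_one₀ (by linarith) h0 h1
  have hZ : ∀ f : X → Bool, Zval Dx yy p f - p * (1 - p) = ∑ x, a x * (bval f x - p) := by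
    intro f
    have : p * (1 - p) = ∑ x, Dx x * (p * (1 - p)) := by rw [← Finset.sum_mul, hDs, one_mul]
    rw [this, Zval, ← Finset.sum_sub_distrib]
    apply Finset.sum_congr rfl
    intro x _
    rw [hadef]
    ring
  have hN : ∀ f : X → Bool, ∑ x, filtered Dx yy p f x * φ x * bval f x =
      (p * (1 - p) * m + ∑ x, b x * (bval f x - p)) / Zval Dx yy p f := by
    intro f
    rw [hm, Finset.mul_sum, ← Finset.sum_add_distrib, Finset.sum_div]
    apply Finset.sum_congr rfl
    intro x _
    have h2 : bval f x * bval f x = bval f x := by unfold bval; split_ifs <;> simp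
    rw [hbdef]
    simp only [filtered]
    rw [div_mul_eq_mul_div, div_mul_eq_mul_div]
    congr 1
    linear_combination (Dx x * φ x * ((1 - p) * yy x - p * (1 - yy x))) * h2
  set t := p * (1 - p) * ε / 4 with ht
  have ht0 : 0 ≤ t := by positivity
  have T1 := aux_tail p hp0 hp1 Dx a ha hσ t ht0
  have T2 := aux_tail p hp0 hp1 Dx (fun x => -a x) (by simpa using ha) hσ t ht0
  have T3 := aux_tail p hp0 hp1 Dx b hb hσ t ht0
  have T4 := aux_tail p hp0 hp1 Dx (fun x => -b x) (by simpa using hb) hσ t ht0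
  have hE : -t ^ 2 / (4 * norm2sq Dx) =
      -(1 / 64 * ε ^ 2 * p ^ 2 * (1 - p) ^ 2) / norm2sq Dx := by
    rw [ht]
    field_simp
    ring
  rw [hE] at T1 T2 T3 T4
  set G : (X → Bool) → Prop := fun f => 0 < Zval Dx yy p f ∧
          |(∑ x, filtered Dx yy p f x * φ x * bval f x) - m| ≤ ε with hG
  have key : 1 ≤ bprob X p G + bprob X p (fun f => t ≤ ∑ x, a x * (bval f x - p))
      + bprob X p (fun f => t ≤ ∑ x, -a x * (bval f x - p))
      + bprob X p (fun f => t ≤ ∑ x, b x * (bval f x - p))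
      + bprob X p (fun f => t ≤ ∑ x, -b x * (bval f x - p)) := by
    rw [← aux_one (X := X) p]
    unfold bprob
    simp only [← Finset.sum_add_distrib, ← mul_add]
    apply Finset.sum_le_sum
    intro f _
    apply le_mul_of_one_le_right (aux_nonneg p hp0 hp1 f)
    have i0 : ∀ P : Prop, (0 : ℝ) ≤ if P then 1 else 0 := by
      intro P; split_ifs <;> norm_num
    have j0 := i0 (G f)
    have j1 := i0 (t ≤ ∑ x, a x * (bval f x - p))
    have j2 := i0 (t ≤ ∑ x, -a x * (bval f x - p))
    have j3 := i0 (t ≤ ∑ x, b x * (bval f x - p))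
    have j4 := i0 (t ≤ ∑ x, -b x * (bval f x - p))
    by_cases c1 : t ≤ ∑ x, a x * (bval f x - p)
    · rw [if_pos c1]; linarith
    by_cases c2 : t ≤ ∑ x, -a x * (bval f x - p)
    · rw [if_pos c2]; linarith
    by_cases c3 : t ≤ ∑ x, b x * (bval f x - p)
    · rw [if_pos c3]; linarith
    by_cases c4 : t ≤ ∑ x, -b x * (bval f x - p)
    · rw [if_pos c4]; linarith
    have g : G f := by
      simp only [neg_mul, Finset.sum_neg_distrib] at c2 c4
      rw [hG]
      simp only
      rw [hN f]
      rw [← hZ f] at c1 c2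
      apply aux_det _ _ m (p * (1 - p)) ε hq he0 he1 hm0 hm1 (not_le.mp c1) (not_le.mp c2)
      · rw [add_sub_cancel_left]; exact not_le.mp c3
      · rw [add_sub_cancel_left]; exact not_le.mp c4
    rw [if_pos g]; linarith
  linarith

end
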